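/- arXiv:1407.6118 — 4 statements merged into one kernel-verified Lean document; each statement's English description precedes it below -/
import Mathlib

section
/- Let L ∈ ℝ^{2n×2n} be symmetric, let K = J₂ₙ L, and let A ∈ ℝ^{2n×2k} be symplectic (Aᵀ J₂ₙ A = J₂ₖ). Then the reduced operator K̃ = A⁺ K A satisfies K̃ = J₂ₖ (Aᵀ L A), where Aᵀ L A is symmetric; in particular K̃ is a Hamiltonian matrix (i.e. J₂ₖᵀ K̃ is symmetric). -/
open Matrix

/-- The Poisson matrix `J₂ₘ = [[0ₘ, Iₘ], [-Iₘ, 0ₘ]]`. -/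
def PoissonJ (m : ℕ) : Matrix (Fin m ⊕ Fin m) (Fin m ⊕ Fin m) ℝ :=
  Matrix.fromBlocks 0 1 (-1) 0

/-- The symplectic inverse `B⁺ = J₂ᵦᵀ Bᵀ J₂ₐ` of a `2a × 2b` real matrix `B`. -/
def symplInv {a b : ℕ} (B : Matrix (Fin a ⊕ Fin a) (Fin b ⊕ Fin b) ℝ) :
    Matrix (Fin b ⊕ Fin b) (Fin a ⊕ Fin a) ℝ :=
  (PoissonJ b)ᵀ * Bᵀ * PoissonJ a

theorem PoissonJ_transpose (m : ℕ) : (PoissonJ m)ᵀ = -PoissonJ m := by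
  simp [PoissonJ, fromBlocks_transpose, fromBlocks_neg]

theorem PoissonJ_mul_self (m : ℕ) : PoissonJ m * PoissonJ m = -1 := by
  simp [PoissonJ, fromBlocks_multiply, ← fromBlocks_one, fromBlocks_neg]

/-- The identity `B⁺ J₂ₐ = J₂ᵦ Bᵀ`, valid for every matrix `B`. -/
theorem symplInv_mul_PoissonJ {a b : ℕ} (B : Matrix (Fin a ⊕ Fin a) (Fin b ⊕ Fin b) ℝ) :
    symplInv B * PoissonJ a = PoissonJ b * Bᵀ := by
  simp [symplInv, Matrix.mul_assoc, PoissonJ_mul_self, PoissonJ_transpose]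

/-- If `L ∈ ℝ^{2n×2n}` is symmetric, `K = J₂ₙ L`, and `A ∈ ℝ^{2n×2k}` is symplectic,
then the reduced operator `K̃ = A⁺ K A` satisfies `K̃ = J₂ₖ (Aᵀ L A)` with `Aᵀ L A`
symmetric; in particular `K̃` is a Hamiltonian matrix, i.e. `J₂ₖᵀ K̃` is symmetric. -/
theorem reduced_operator_hamiltonian {n k : ℕ}
    (L : Matrix (Fin n ⊕ Fin n) (Fin n ⊕ Fin n) ℝ) (hL : L.IsSymm)
    (A : Matrix (Fin n ⊕ Fin n) (Fin k ⊕ Fin k) ℝ)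
    (hA : Aᵀ * PoissonJ n * A = PoissonJ k) :
    symplInv A * (PoissonJ n * L) * A = PoissonJ k * (Aᵀ * L * A) ∧
    (Aᵀ * L * A).IsSymm ∧
    ((PoissonJ k)ᵀ * (symplInv A * (PoissonJ n * L) * A)).IsSymm := by
  have hK : symplInv A * (PoissonJ n * L) * A = PoissonJ k * (Aᵀ * L * A) := by
    rw [← Matrix.mul_assoc, symplInv_mul_PoissonJ]
    simp only [Matrix.mul_assoc]
  have hS : (Aᵀ * L * A).IsSymm := by
    simp [IsSymm, Matrix.mul_assoc, hL.eq]
  refine ⟨hK, hS, ?_⟩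
  rw [hK, ← Matrix.mul_assoc, PoissonJ_transpose, Matrix.neg_mul, PoissonJ_mul_self, neg_neg,
    Matrix.one_mul]
  exact hS
end

section
/- Let H : ℝ^{2n} → ℝ be continuously differentiable and let x₀ ∈ ℝ^{2n}. Suppose S is a bounded open neighborhood of x₀ in ℝ^{2n} such that either H(x₀) < H(x) for all x on the boundary ∂S, or H(x₀) > H(x) for all x ∈ ∂S. If x : ℝ → ℝ^{2n} is differentiable and solves the Hamiltonian system ẋ(t) = J₂ₙ ∇H(x(t)) with x(0) = x₀, then x(t) ∈ S for all t ∈ ℝ; in particular the solution is bounded. -/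
open Matrix

/-- The Euclidean gradient of `H : ℝ^ι → ℝ`: its `i`-th component is the partial
derivative of `H` in the `i`-th coordinate direction. -/
noncomputable def egrad {ι : Type*} [Fintype ι] [DecidableEq ι]
    (H : (ι → ℝ) → ℝ) (x : ι → ℝ) : ι → ℝ :=
  fun i => fderiv ℝ H x (Pi.single i 1)
theorem fderiv_apply_eq_egrad_dotProduct {ι : Type*} [Fintype ι] [DecidableEq ι]
    (H : (ι → ℝ) → ℝ) (x v : ι → ℝ) : fderiv ℝ H x v = egrad H x ⬝ᵥ v := by
  have h := LinearMap.pi_apply_eq_sum_univ (fderiv ℝ H x).toLinearMap v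
  simp only [ContinuousLinearMap.coe_coe, smul_eq_mul] at h
  rw [h, dotProduct]
  refine Finset.sum_congr rfl fun i _ => ?_
  rw [mul_comm, egrad]
  congr 2
  ext j
  simp [Pi.single_apply, eq_comm]

theorem dotProduct_PoissonJ_mulVec_self {m : ℕ} (v : Fin m ⊕ Fin m → ℝ) :
    v ⬝ᵥ (PoissonJ m).mulVec v = 0 := by
  rw [PoissonJ, Matrix.fromBlocks_mulVec]
  simp [dotProduct, Fintype.sum_sum_type, Matrix.neg_mulVec, mul_comm]

/-- The Hamiltonian is constant along solutions of the Hamiltonian system. -/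
theorem hamiltonian_conserved {n : ℕ} {H : (Fin n ⊕ Fin n → ℝ) → ℝ} (hH : Differentiable ℝ H)
    {x : ℝ → Fin n ⊕ Fin n → ℝ}
    (hx : ∀ t, HasDerivAt x ((PoissonJ n).mulVec (egrad H (x t))) t) (s t : ℝ) :
    H (x s) = H (x t) := by
  have hderiv (r : ℝ) : HasDerivAt (H ∘ x) 0 r := by
    have h := (hH (x r)).hasFDerivAt.comp_hasDerivAt r (hx r)
    rwa [fderiv_apply_eq_egrad_dotProduct, dotProduct_PoissonJ_mulVec_self] at h
  exact is_const_of_deriv_eq_zero (fun r => (hderiv r).differentiableAt)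
    (fun r => (hderiv r).deriv) s t

/-- Theorem 3.9 (boundedness of the full Hamiltonian system): if `H : ℝ^{2n} → ℝ` is `C¹`
and `S` is a bounded open neighborhood of `x₀` with `H(x₀) < H(x)` for all `x ∈ ∂S`
(or `H(x₀) > H(x)` for all `x ∈ ∂S`), then any solution `x` of `ẋ = J₂ₙ ∇H(x)` with
`x(0) = x₀` satisfies `x(t) ∈ S` for all `t ∈ ℝ`; in particular it is bounded. -/
theorem hamiltonian_solution_stays_in_S {n : ℕ}
    (H : ((Fin n ⊕ Fin n) → ℝ) → ℝ) (hH : ContDiff ℝ 1 H)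
    (x₀ : (Fin n ⊕ Fin n) → ℝ)
    (S : Set ((Fin n ⊕ Fin n) → ℝ)) (hSopen : IsOpen S)
    (hSbdd : Bornology.IsBounded S) (hx₀S : x₀ ∈ S)
    (hbd : (∀ x ∈ frontier S, H x₀ < H x) ∨ (∀ x ∈ frontier S, H x < H x₀))
    (x : ℝ → (Fin n ⊕ Fin n) → ℝ)
    (hx : ∀ t, HasDerivAt x ((PoissonJ n).mulVec (egrad H (x t))) t)
    (hx0 : x 0 = x₀) :
    ∀ t : ℝ, x t ∈ S := by
  intro t
  have hcont : Continuous x := continuous_iff_continuousAt.2 fun s => (hx s).continuousAt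
  by_contra ht
  obtain ⟨s, hs'⟩ : (frontier (x ⁻¹' S)).Nonempty :=
    nonempty_frontier_iff.2 ⟨⟨0, by simpa [hx0] using hx₀S⟩,
      fun h => ht (Set.eq_univ_iff_forall.1 h t)⟩
  have hs : x s ∈ frontier S := hcont.frontier_preimage_subset S hs'
  have hHs : H (x s) = H x₀ :=
    hx0 ▸ hamiltonian_conserved (hH.differentiable one_ne_zero) hx s 0
  rcases hbd with h | h
  · exact (h _ hs).ne' hHs
  · exact (h _ hs).ne hHs
end

section
/- Let H : ℝ^{2n} → ℝ be continuously differentiable and let A ∈ ℝ^{2n×2k} be symplectic (Aᵀ J₂ₙ A = J₂ₖ). Suppose x⋆ ∈ Range(A) is a strict local minimum (or strict local maximum) of H, i.e. there is a neighborhood N of x⋆ with H(x) > H(x⋆) (respectively H(x) < H(x⋆)) for all x ∈ N \ {x⋆}. Let z⋆ = A⁺x⋆. Then z⋆ is a stable equilibrium of the reduced Hamiltonian system ż = J₂ₖ ∇(H∘A)(z): for every ε > 0 there exists δ > 0 such that every differentiable solution z : [0,∞) → ℝ^{2k} of ż(t) = J₂ₖ ∇(H∘A)(z(t)) with ‖z(0)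 − z⋆‖ < δ satisfies ‖z(t) − z⋆‖ < ε for all t ≥ 0. -/
open Matrix

/-- The Euclidean norm of a vector in `ℝ^ι`. -/
noncomputable def enorm' {ι : Type*} [Fintype ι] (v : ι → ℝ) : ℝ :=
  Real.sqrt (∑ i, (v i) ^ 2)

/-- The Poisson matrix is orthogonal. -/
theorem PoissonJ_transpose_mul_self (m : ℕ) : (PoissonJ m)ᵀ * PoissonJ m = 1 := by
  simp [PoissonJ, Matrix.fromBlocks_transpose, Matrix.fromBlocks_multiply]

/-- The Poisson matrix is skew: its quadratic form vanishes. -/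
theorem PoissonJ_mulVec_dotProduct_self {m : ℕ} (g : Fin m ⊕ Fin m → ℝ) :
    (PoissonJ m).mulVec g ⬝ᵥ g = 0 := by
  simp only [PoissonJ, Matrix.fromBlocks_mulVec, dotProduct, Fintype.sum_sum_type, Sum.elim_inl,
    Sum.elim_inr]
  simp [Matrix.neg_mulVec, mul_comm]

/-- The symplectic inverse is a left inverse of a symplectic matrix. -/
theorem symplInv_mul_self {a b : ℕ} {B : Matrix (Fin a ⊕ Fin a) (Fin b ⊕ Fin b) ℝ}
    (hB : Bᵀ * PoissonJ a * B = PoissonJ b) : symplInv B * B = 1 := by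
  rw [symplInv, Matrix.mul_assoc, Matrix.mul_assoc, ← Matrix.mul_assoc Bᵀ, hB,
    PoissonJ_transpose_mul_self]

/-- The derivative of `F` in direction `v` is the inner product of `v` with the gradient. -/
theorem fderiv_apply_eq_dotProduct_egrad {ι : Type*} [Fintype ι] [DecidableEq ι]
    (F : (ι → ℝ) → ℝ) (x v : ι → ℝ) : fderiv ℝ F x v = v ⬝ᵥ egrad F x := by
  conv_lhs => rw [pi_eq_sum_univ' v]
  simp [egrad, dotProduct]

/-- The Hamiltonian is conserved along solutions of its Hamiltonian system. -/
theorem hamiltonian_conserved_s11 {m : ℕ} {F : (Fin m ⊕ Fin m → ℝ) → ℝ} (hF : Differentiable ℝ F)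
    {z : ℝ → Fin m ⊕ Fin m → ℝ}
    (hz : ∀ t ∈ Set.Ici (0 : ℝ),
      HasDerivWithinAt z ((PoissonJ m).mulVec (egrad F (z t))) (Set.Ici 0) t)
    {t : ℝ} (ht : 0 ≤ t) : F (z t) = F (z 0) := by
  have hderiv : ∀ s ∈ Set.Ici (0 : ℝ), HasDerivWithinAt (F ∘ z) 0 (Set.Ici 0) s := by
    intro s hs
    have h := (hF (z s)).hasFDerivAt.comp_hasDerivWithinAt s (hz s hs)
    rwa [fderiv_apply_eq_dotProduct_egrad, PoissonJ_mulVec_dotProduct_self] at h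
  refine constant_of_has_deriv_right_zero (f := F ∘ z) (a := 0) (b := t) ?_ ?_ t
    (Set.right_mem_Icc.2 ht)
  · exact fun s hs => ((hderiv s hs.1).continuousWithinAt).mono fun u hu => hu.1
  · exact fun s hs => (hderiv s hs.1).mono (Set.Ici_subset_Ici.2 hs.1)

/-- A strict local minimum of a continuous conserved quantity is Lyapunov stable. -/
theorem stable_of_conserved_of_strict_min {E : Type*} [MetricSpace E] [ProperSpace E]
    {V : E → ℝ} (hV : Continuous V) {x₀ : E} (hmin : ∀ᶠ x in nhds x₀, x ≠ x₀ → V x₀ < V x)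
    {U : Set E} (hU : U ∈ nhds x₀) :
    ∃ W ∈ nhds x₀, ∀ z : ℝ → E, ContinuousOn z (Set.Ici 0) →
      (∀ t ≥ (0 : ℝ), V (z t) = V (z 0)) → z 0 ∈ W → ∀ t ≥ (0 : ℝ), z t ∈ U := by
  obtain ⟨r, hr, hball⟩ := Metric.nhds_basis_closedBall.mem_iff.1 (Filter.inter_mem hU hmin)
  obtain ⟨c, hc, hsphere⟩ : ∃ c > V x₀, ∀ y ∈ Metric.sphere x₀ r, c ≤ V y := by
    rcases (Metric.sphere x₀ r).eq_empty_or_nonempty with he | hne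
    · exact ⟨V x₀ + 1, by simp, by simp [he]⟩
    · obtain ⟨y, hy, hymin⟩ := (isCompact_sphere x₀ r).exists_isMinOn hne hV.continuousOn
      exact ⟨V y, (hball (Metric.sphere_subset_closedBall hy)).2 (Metric.ne_of_mem_sphere hy hr.ne'),
        fun w hw => hymin hw⟩
  refine ⟨Metric.ball x₀ r ∩ {x | V x < c},
    Filter.inter_mem (Metric.ball_mem_nhds x₀ hr) (hV.continuousAt.eventually_lt_const hc), ?_⟩
  intro z hz hcons hz0 t ht
  by_contra hzt
  have hfar : r ≤ dist (z t) x₀ := by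
    by_contra! h
    exact hzt (hball (Metric.mem_closedBall.2 h.le)).1
  have hcont : ContinuousOn (fun s => dist (z s) x₀) (Set.Icc 0 t) :=
    (continuous_id.dist continuous_const).comp_continuousOn (hz.mono Set.Icc_subset_Ici_self)
  obtain ⟨s, hs, hsr⟩ := intermediate_value_Icc ht hcont ⟨(Metric.mem_ball.1 hz0.1).le, hfar⟩
  have h1 := hsphere (z s) hsr
  rw [hcons s hs.1] at h1
  exact absurd hz0.2 (not_lt.2 h1)

/-- The sup norm is bounded by the Euclidean norm. -/
theorem norm_le_enorm' {ι : Type*} [Fintype ι] (v : ι → ℝ) : ‖v‖ ≤ enorm' v := by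
  refine (pi_norm_le_iff_of_nonneg (Real.sqrt_nonneg _)).2 fun i => ?_
  rw [Real.norm_eq_abs]
  exact Real.abs_le_sqrt
    (Finset.single_le_sum (f := fun j => v j ^ 2) (fun j _ => sq_nonneg _) (Finset.mem_univ i))

/-- The Euclidean norm is continuous. -/
theorem continuous_enorm' {ι : Type*} [Fintype ι] :
    Continuous (enorm' : (ι → ℝ) → ℝ) := by
  unfold enorm'
  fun_prop

/-- Theorem 3.10 (stability preservation): if `H : ℝ^{2n} → ℝ` is `C¹`,
`A ∈ ℝ^{2n×2k}` is symplectic, and `x⋆ ∈ Range(A)` is a strict local minimum (or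
strict local maximum) of `H`, then `z⋆ = A⁺x⋆` is a stable equilibrium of the
reduced Hamiltonian system `ż = J₂ₖ ∇(H∘A)(z)`: for every `ε > 0` there is `δ > 0`
such that every solution `z : [0,∞) → ℝ^{2k}` with `‖z(0) − z⋆‖ < δ` satisfies
`‖z(t) − z⋆‖ < ε` for all `t ≥ 0`. -/
theorem reduced_stable_equilibrium {n k : ℕ}
    (H : ((Fin n ⊕ Fin n) → ℝ) → ℝ) (hH : ContDiff ℝ 1 H)
    (A : Matrix (Fin n ⊕ Fin n) (Fin k ⊕ Fin k) ℝ)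
    (hA : Aᵀ * PoissonJ n * A = PoissonJ k)
    (xstar : (Fin n ⊕ Fin n) → ℝ) (hxstar : xstar ∈ Set.range A.mulVec)
    (N : Set ((Fin n ⊕ Fin n) → ℝ)) (hN : N ∈ nhds xstar)
    (hext : (∀ x ∈ N \ {xstar}, H xstar < H x) ∨ (∀ x ∈ N \ {xstar}, H x < H xstar)) :
    ∀ ε > (0 : ℝ), ∃ δ > (0 : ℝ), ∀ z : ℝ → (Fin k ⊕ Fin k) → ℝ,
      (∀ t ∈ Set.Ici (0 : ℝ), HasDerivWithinAt z
        ((PoissonJ k).mulVec (egrad (fun w => H (A.mulVec w)) (z t))) (Set.Ici 0) t) →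
      enorm' (z 0 - (symplInv A).mulVec xstar) < δ →
      ∀ t ≥ (0 : ℝ), enorm' (z t - (symplInv A).mulVec xstar) < ε := by
  obtain ⟨w, rfl⟩ := hxstar
  have hleft : ∀ v, (symplInv A).mulVec (A.mulVec v) = v := fun v => by
    rw [Matrix.mulVec_mulVec, symplInv_mul_self hA, Matrix.one_mulVec]
  rw [hleft]
  have hA_cont : Continuous A.mulVec := Continuous.matrix_mulVec continuous_const continuous_id
  have hF : Differentiable ℝ fun v => H (A.mulVec v) :=
    (hH.differentiable one_ne_zero).comp A.mulVecLin.toContinuousLinearMap.differentiable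
  have hN' : ∀ᶠ v in nhds w, A.mulVec v ∈ N := hA_cont.continuousAt.eventually hN
  have hne : ∀ v, v ≠ w → A.mulVec v ≠ A.mulVec w := fun v hv h =>
    hv ((Function.LeftInverse.injective hleft) h)
  intro ε hε
  have hU : {v | enorm' (v - w) < ε} ∈ nhds w := by
    have hcont : Continuous fun v => enorm' (v - w) :=
      continuous_enorm'.comp (continuous_id.sub continuous_const)
    exact hcont.continuousAt.eventually_lt_const (by simpa [enorm'] using hε)
  obtain ⟨W, hW, hstable⟩ : ∃ W ∈ nhds w, ∀ z : ℝ → (Fin k ⊕ Fin k) → ℝ,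
      ContinuousOn z (Set.Ici 0) →
      (∀ t ≥ (0 : ℝ), H (A.mulVec (z t)) = H (A.mulVec (z 0))) →
      z 0 ∈ W → ∀ t ≥ (0 : ℝ), z t ∈ {v | enorm' (v - w) < ε} := by
    rcases hext with hmin | hmax
    · exact stable_of_conserved_of_strict_min hF.continuous
        (hN'.mono fun v hv hvw => hmin _ ⟨hv, hne v hvw⟩) hU
    · obtain ⟨W, hW, h⟩ := stable_of_conserved_of_strict_min hF.continuous.neg
        (hN'.mono fun v hv hvw => neg_lt_neg (hmax _ ⟨hv, hne v hvw⟩)) hU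
      exact ⟨W, hW, fun z hz hcons => h z hz fun t ht => congrArg Neg.neg (hcons t ht)⟩
  obtain ⟨δ, hδ, hball⟩ := Metric.mem_nhds_iff.1 hW
  refine ⟨δ, hδ, fun z hz hz0 => hstable z (fun t ht => (hz t ht).continuousWithinAt)
    (fun t ht => hamiltonian_conserved_s11 hF hz ht) (hball ?_)⟩
  rw [mem_ball_iff_norm]
  exact (norm_le_enorm' _).trans_lt hz0
end

section
/- Let Φ, Ψ ∈ ℝ^{n×k} and A₂ = [[Φ, −Ψ], [Ψ, Φ]] ∈ ℝ^{2n×2k}. Then A₂⁺ = A₂ᵀ, where A₂⁺ = J₂ₖᵀ A₂ᵀ J₂ₙ. Moreover, A₂ᵀ J₂ₙ A₂ = J₂ₖ if and only if A₂ᵀ A₂ = I₂ₖ; that is, a matrix of this block form is symplectic if and only if it has orthonormal columns. -/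
open Matrix

/-- The map `𝒜` sending a complex matrix `M = Φ + iΨ` to the real block matrix
`[[Φ, −Ψ], [Ψ, Φ]]`. -/
def calA {a b : Type*} (M : Matrix a b ℂ) : Matrix (a ⊕ a) (b ⊕ b) ℝ :=
  Matrix.fromBlocks (M.map Complex.re) (-(M.map Complex.im))
    (M.map Complex.im) (M.map Complex.re)
/-- Transposes of matrices of the block form `[[Φ, −Ψ], [Ψ, Φ]]` intertwine the Poisson
matrices. -/
theorem transpose_blockForm_mul_PoissonJ {n k : ℕ} (Φ Ψ : Matrix (Fin n) (Fin k) ℝ) :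
    (fromBlocks Φ (-Ψ) Ψ Φ)ᵀ * PoissonJ n = PoissonJ k * (fromBlocks Φ (-Ψ) Ψ Φ)ᵀ := by
  simp [PoissonJ, fromBlocks_transpose, fromBlocks_multiply]

/-- For `Φ, Ψ ∈ ℝ^{n×k}` and `A₂ = [[Φ, −Ψ], [Ψ, Φ]]`: the symplectic inverse
satisfies `A₂⁺ = A₂ᵀ`, and `A₂` is symplectic (`A₂ᵀ J₂ₙ A₂ = J₂ₖ`) iff it has
orthonormal columns (`A₂ᵀ A₂ = I₂ₖ`). -/
theorem blockForm_symplInv_eq_transpose {n k : ℕ} (Φ Ψ : Matrix (Fin n) (Fin k) ℝ) :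
    symplInv (Matrix.fromBlocks Φ (-Ψ) Ψ Φ) = (Matrix.fromBlocks Φ (-Ψ) Ψ Φ)ᵀ ∧
    ((Matrix.fromBlocks Φ (-Ψ) Ψ Φ)ᵀ * PoissonJ n * Matrix.fromBlocks Φ (-Ψ) Ψ Φ =
        PoissonJ k ↔
      (Matrix.fromBlocks Φ (-Ψ) Ψ Φ)ᵀ * Matrix.fromBlocks Φ (-Ψ) Ψ Φ = 1) := by
  refine ⟨?_, ?_⟩
  · rw [symplInv, Matrix.mul_assoc, transpose_blockForm_mul_PoissonJ, ← Matrix.mul_assoc,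
      PoissonJ_transpose_mul_self, Matrix.one_mul]
  · rw [transpose_blockForm_mul_PoissonJ, Matrix.mul_assoc]
    constructor
    · intro h
      have h' := congrArg ((PoissonJ k)ᵀ * ·) h
      simpa only [← Matrix.mul_assoc, PoissonJ_transpose_mul_self, Matrix.one_mul] using h'
    · intro h
      rw [h, Matrix.mul_one]
end
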